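/- arXiv:1209.1584 — 2 statements merged into one kernel-verified Lean document; each statement's English description precedes it below -/
import Mathlib

section
/- Let i, j ∈ {1, …, n} with j ∉ {i−1, i, i+1} (indices mod n). Then there exists ε ∈ (0, π/2) such that for every τ ∈ [−σ_j, σ_j], the complex number w = e^{−iα_i}(m_j + τ e^{iα_j} − m_i) is nonzero and satisfies Im w ≥ sin(ε)·|w|; equivalently, ε ≤ arg w ≤ π − ε. -/
open MeasureTheory Complex

/-- The angle `α_i ∈ (-π, π]` that the edge `(z_i, z_{i+1})` makes with the positive real
axis, i.e. `e^{iα_i} = (z_{i+1} - z_i)/|z_{i+1} - z_i|`. -/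
noncomputable def dirAngle {n : ℕ} [NeZero n] (z : Fin n → ℂ) (i : Fin n) : ℝ :=
  (z (i + 1) - z i).arg

/-- Half the length of the edge `(z_i, z_{i+1})`, i.e. `σ_i`. -/
noncomputable def halfLen {n : ℕ} [NeZero n] (z : Fin n → ℂ) (i : Fin n) : ℝ :=
  ‖z (i + 1) - z i‖ / 2

/-- The midpoint `m_i` of the edge `(z_i, z_{i+1})`. -/
noncomputable def midpt {n : ℕ} [NeZero n] (z : Fin n → ℂ) (i : Fin n) : ℂ :=
  (z i + z (i + 1)) / 2

/-- `z : Fin n → ℂ` lists the vertices of a bounded convex polygon in counterclockwise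
order (each vertex an extreme point of the closure): every vertex other than the two
endpoints of a directed edge lies strictly to the left of that edge. -/
def IsCCWConvexPolygon {n : ℕ} [NeZero n] (z : Fin n → ℂ) : Prop :=
  3 ≤ n ∧ ∀ i k : Fin n, k ≠ i → k ≠ i + 1 →
    0 < ((starRingEnd ℂ) (z (i + 1) - z i) * (z k - z i)).im

theorem halfLen_mul_exp_dirAngle {n : ℕ} [NeZero n] (z : Fin n → ℂ) (i : Fin n) :
    (halfLen z i : ℂ) * exp (I * (dirAngle z i : ℝ)) = (z (i + 1) - z i) / 2 := by
  rw [halfLen, dirAngle, mul_comm I, ofReal_div, ofReal_ofNat, div_mul_eq_mul_div,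
    norm_mul_exp_arg_mul_I]

theorem norm_mul_exp_neg_dirAngle {n : ℕ} [NeZero n] (z : Fin n → ℂ) (i : Fin n) :
    (‖z (i + 1) - z i‖ : ℂ) * exp (-(I * (dirAngle z i : ℝ))) =
      (starRingEnd ℂ) (z (i + 1) - z i) := by
  conv_rhs => rw [← norm_mul_exp_arg_mul_I (z (i + 1) - z i)]
  rw [map_mul, conj_ofReal, ← exp_conj, map_mul, conj_ofReal, conj_I, dirAngle]
  congr 2
  ring

/-- A vertex off the `i`-th edge has positive height over that edge. -/
theorem IsCCWConvexPolygon.im_rotate_sub_midpt_pos {n : ℕ} [NeZero n] {z : Fin n → ℂ}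
    (hz : IsCCWConvexPolygon z) {i k : Fin n} (hk : k ≠ i) (hk' : k ≠ i + 1) :
    0 < (exp (-(I * (dirAngle z i : ℝ))) * (z k - midpt z i)).im := by
  have h := hz.2 i k hk hk'
  have hm : ((starRingEnd ℂ) (z (i + 1) - z i) * (z k - midpt z i)).im =
      ((starRingEnd ℂ) (z (i + 1) - z i) * (z k - z i)).im := by
    have e : z k - midpt z i = z k - z i - (z (i + 1) - z i) / 2 := by
      rw [midpt]; ring
    rw [e, mul_sub, sub_im, ← mul_div_assoc, mul_comm _ (z (i + 1) - z i), mul_conj]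
    norm_cast
    simp
  rw [← hm, ← norm_mul_exp_neg_dirAngle, mul_assoc, im_ofReal_mul] at h
  exact pos_of_mul_pos_right h (norm_nonneg _)

/-- A real affine function on `[-h, h]` is bounded below by the minimum of its endpoint values. -/
theorem le_add_mul_of_mem_Icc {a b c h τ : ℝ} (h₁ : c ≤ a - h * b) (h₂ : c ≤ a + h * b)
    (hτ : τ ∈ Set.Icc (-h) h) : c ≤ a + τ * b := by
  obtain ⟨hl, hr⟩ := hτ
  rcases le_total 0 b with hb | hb <;> nlinarith

/-- If `j ∉ {i-1, i, i+1}` then there is `ε ∈ (0, π/2)` such that for all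
`τ ∈ [-σ_j, σ_j]` the number `w = e^{-iα_i}(m_j + τ e^{iα_j} - m_i)` is nonzero and
satisfies `Im w ≥ sin(ε)·|w|`, i.e. `ε ≤ arg w ≤ π - ε`. -/
theorem stmt6 {n : ℕ} [NeZero n] (z : Fin n → ℂ) (hz : IsCCWConvexPolygon z)
    (i j : Fin n) (hji : j ≠ i) (hjm : j ≠ i - 1) (hjp : j ≠ i + 1) :
    ∃ ε : ℝ, ε ∈ Set.Ioo 0 (Real.pi / 2) ∧
      ∀ τ ∈ Set.Icc (-(halfLen z j)) (halfLen z j),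
        Complex.exp (-(Complex.I * (dirAngle z i : ℝ))) *
            (midpt z j + (τ : ℂ) * Complex.exp (Complex.I * (dirAngle z j : ℝ)) - midpt z i)
          ≠ 0 ∧
        Real.sin ε *
            ‖Complex.exp (-(Complex.I * (dirAngle z i : ℝ))) *
              (midpt z j + (τ : ℂ) * Complex.exp (Complex.I * (dirAngle z j : ℝ)) -
                midpt z i)‖ ≤
          (Complex.exp (-(Complex.I * (dirAngle z i : ℝ))) *
            (midpt z j + (τ : ℂ) * Complex.exp (Complex.I * (dirAngle z j : ℝ)) -
              midpt z i)).im := by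
  set u := exp (-(I * (dirAngle z i : ℝ))) with hu
  set v := exp (I * (dirAngle z j : ℝ)) with hv
  have hnu : ‖u‖ = 1 := by simp [hu, norm_exp]
  have hnv : ‖v‖ = 1 := by simp [hv, norm_exp]
  have hhalf := halfLen_mul_exp_dirAngle z j
  rw [← hv] at hhalf
  have hA := hz.im_rotate_sub_midpt_pos hji hjp
  have hB := hz.im_rotate_sub_midpt_pos (i := i) (k := j + 1)
    (fun h => hjm (eq_sub_of_add_eq h)) (fun h => hji (add_right_cancel h))
  rw [← hu] at hA hB
  set h := halfLen z j with hh
  have key : ∀ τ : ℝ, (u * (midpt z j + (τ : ℂ) * v - midpt z i)).im =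
      (u * (midpt z j - midpt z i)).im + τ * (u * v).im := by
    intro τ
    rw [← im_ofReal_mul, ← add_im]
    congr 1
    ring
  have e₁ : z j = midpt z j + ((-h : ℝ) : ℂ) * v := by
    rw [ofReal_neg, neg_mul, hhalf, midpt]; ring
  have e₂ : z (j + 1) = midpt z j + (h : ℂ) * v := by
    rw [hhalf, midpt]; ring
  rw [e₁, key, neg_mul, ← sub_eq_add_neg] at hA
  rw [e₂, key] at hB
  obtain ⟨c, hc, hcA, hcB⟩ : ∃ c : ℝ, 0 < c ∧
      c ≤ (u * (midpt z j - midpt z i)).im - h * (u * v).im ∧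
      c ≤ (u * (midpt z j - midpt z i)).im + h * (u * v).im :=
    ⟨_, lt_min hA hB, min_le_left _ _, min_le_right _ _⟩
  have hh0 : 0 ≤ h := by rw [hh, halfLen]; positivity
  set M : ℝ := ‖midpt z j - midpt z i‖ + h with hM
  have hM0 : 0 ≤ M := by positivity
  have hs0 : 0 < c / (M + c + 1) := by positivity
  have hs1 : c / (M + c + 1) < 1 := by
    rw [div_lt_one (by positivity)]; linarith
  refine ⟨Real.arcsin (c / (M + c + 1)),
    ⟨Real.arcsin_pos.2 hs0, Real.arcsin_lt_pi_div_two.2 hs1⟩, fun τ hτ => ?_⟩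
  have him : c ≤ (u * (midpt z j + (τ : ℂ) * v - midpt z i)).im := by
    rw [key]; exact le_add_mul_of_mem_Icc hcA hcB hτ
  have hnorm : ‖u * (midpt z j + (τ : ℂ) * v - midpt z i)‖ ≤ M := by
    rw [norm_mul, hnu, one_mul, add_sub_right_comm]
    refine (norm_add_le _ _).trans ?_
    rw [norm_mul, hnv, mul_one, norm_real, Real.norm_eq_abs, hM]
    gcongr
    exact abs_le.2 hτ
  refine ⟨fun h0 => ?_, ?_⟩
  · rw [h0, zero_im] at him
    linarith
  · rw [Real.sin_arcsin (by linarith) hs1.le]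
    refine le_trans (mul_le_mul_of_nonneg_left hnorm hs0.le) (le_trans ?_ him)
    rw [div_mul_eq_mul_div, div_le_iff₀ (by positivity)]
    nlinarith
end

section
/- Let U ⊆ ℂ be an open set containing the closure of Ω and let q : U → ℝ be harmonic (twice continuously differentiable with Δq = 0 on U). Define (∂q/∂z)(z) = (1/2)(∂q/∂x − i ∂q/∂y)(z). Then the global relation holds: for every λ ∈ ℂ, Σ_{i=1}^n ∫_0^1 e^{−iλ(z_i + t(z_{i+1}−z_i))} · (∂q/∂z)(z_i + t(z_{i+1}−z_i)) · (z_{i+1} − z_i) dt = 0, i.e. the spectral functions ρ_i(λ) = ∫_{Γ_i} e^{−iλz}(∂q/∂z) dz satisfy Σ_{i=1}^n ρ_i(λ) = 0. -/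
open MeasureTheory Complex

/-- The Wirtinger derivative `∂q/∂z = (1/2)(∂q/∂x - i ∂q/∂y)` of a real valued function
`q : ℂ → ℝ`. -/
noncomputable def dqdz (q : ℂ → ℝ) (w : ℂ) : ℂ :=
  (((fderiv ℝ q w 1 : ℝ) : ℂ) - Complex.I * ((fderiv ℝ q w Complex.I : ℝ) : ℂ)) / 2

/-- A holomorphic function on a convex open set has a primitive. -/
theorem DifferentiableOn.exists_primitive_of_convex {f : ℂ → ℂ} {s : Set ℂ}
    (hs : Convex ℝ s) (hso : IsOpen s) (hf : DifferentiableOn ℂ f s) :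
    ∃ F : ℂ → ℂ, ∀ a ∈ s, HasDerivAt F (f a) a := by
  have hω : ∀ a ∈ s, HasFDerivAt (fun x => ContinuousLinearMap.toSpanSingleton ℂ (f x))
      (((ContinuousLinearMap.toSpanSingletonCLE (𝕜 := ℂ) (E := ℂ) :
        ℂ →L[ℂ] ℂ →L[ℂ] ℂ).comp (fderiv ℂ f a)).restrictScalars ℝ) a := fun a ha =>
    (((ContinuousLinearMap.toSpanSingletonCLE (𝕜 := ℂ) (E := ℂ) :
      ℂ →L[ℂ] ℂ →L[ℂ] ℂ).hasFDerivAt.comp a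
        (hf.differentiableAt (hso.mem_nhds ha)).hasFDerivAt)).restrictScalars ℝ
  obtain ⟨F, hF⟩ := hs.exists_forall_hasFDerivAt_of_fderiv_symmetric hso
    (fun a ha => (hω a ha).differentiableAt.differentiableWithinAt) (by
      intro a ha x y
      rw [(hω a ha).fderiv]
      simp
      ring)
  exact ⟨F, fun a ha => by simpa using (hF a ha).hasDerivAt⟩

/-- The integral of a holomorphic function along a segment inside the domain of a primitive is
the increment of the primitive. -/
theorem integral_segment_eq_sub_of_hasDerivAt {f F : ℂ → ℂ} {s : Set ℂ} (hs : Convex ℝ s)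
    (hf : ContinuousOn f s) (hF : ∀ a ∈ s, HasDerivAt F (f a) a)
    {a b : ℂ} (ha : a ∈ s) (hb : b ∈ s) :
    ∫ t in (0 : ℝ)..1, f (a + (t : ℂ) * (b - a)) * (b - a) = F b - F a := by
  have hmem : ∀ t ∈ Set.uIcc (0 : ℝ) 1, a + (t : ℂ) * (b - a) ∈ s := fun t ht => by
    rw [Set.uIcc_of_le zero_le_one] at ht
    simpa using hs.add_smul_sub_mem ha hb ht
  have hγ : Continuous fun t : ℝ => a + (t : ℂ) * (b - a) := by fun_prop
  rw [intervalIntegral.integral_eq_sub_of_hasDerivAt (f := fun t : ℝ => F (a + (t : ℂ) * (b - a)))]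
  · simp
  · intro t ht
    have hline : HasDerivAt (fun t : ℝ => a + (t : ℂ) * (b - a)) (b - a) t := by
      simpa using ((Complex.ofRealCLM.hasDerivAt (x := t)).mul_const (b - a)).const_add a
    exact (hF _ (hmem t ht)).comp t hline
  · exact ((hf.comp hγ.continuousOn hmem).mul continuousOn_const).intervalIntegrable

/-- A twice continuously differentiable function whose pure second partial derivatives along `1`
and `I` sum to zero on an open set is harmonic at each of its points. -/
theorem harmonicAt_of_fderiv_fderiv_add_eq_zero {q : ℂ → ℝ} {U : Set ℂ} (hU : IsOpen U)
    (hq : ContDiffOn ℝ 2 q U)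
    (hharm : ∀ w ∈ U,
      fderiv ℝ (fun u => fderiv ℝ q u 1) w 1 +
        fderiv ℝ (fun u => fderiv ℝ q u Complex.I) w Complex.I = 0) {w : ℂ} (hw : w ∈ U) :
    InnerProductSpace.HarmonicAt q w := by
  refine ⟨hq.contDiffAt (hU.mem_nhds hw), ?_⟩
  filter_upwards [hU.mem_nhds hw] with x hx
  have hd : DifferentiableAt ℝ (fderiv ℝ q) x :=
    ((hq.contDiffAt (hU.mem_nhds hx)).fderiv_right (m := 1) (by norm_num)).differentiableAt
      (by norm_num)
  have h := hharm x hx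
  rw [fderiv_clm_apply hd (by fun_prop), fderiv_clm_apply hd (by fun_prop)] at h
  simpa [InnerProductSpace.laplacian_eq_iteratedFDeriv_complexPlane, iteratedFDeriv_two_apply]
    using h

/-- `dqdz q` is holomorphic wherever `q` is harmonic. -/
theorem differentiableAt_dqdz {q : ℂ → ℝ} {w : ℂ} (hq : InnerProductSpace.HarmonicAt q w) :
    DifferentiableAt ℂ (dqdz q) w :=
  (HarmonicAt.differentiableAt_complex_partial hq).div_const 2

/-- Let `U ⊇ closure Ω` be open and `q : U → ℝ` harmonic (C² with
`Δq = 0` on `U`).  Then the global relation `Σ_{i=1}^n ρ_i(λ) = 0` holds for every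
`λ ∈ ℂ`, where `ρ_i(λ) = ∫_{Γ_i} e^{-iλz} (∂q/∂z) dz` is the contour integral along the
edge from `z_i` to `z_{i+1}`. -/
theorem stmt19 {n : ℕ} [NeZero n] (z : Fin n → ℂ) (hz : IsCCWConvexPolygon z)
    (U : Set ℂ) (hU : IsOpen U) (hΩU : convexHull ℝ (Set.range z) ⊆ U)
    (q : ℂ → ℝ) (hq : ContDiffOn ℝ 2 q U)
    (hharm : ∀ w ∈ U,
      fderiv ℝ (fun u => fderiv ℝ q u 1) w 1 +
        fderiv ℝ (fun u => fderiv ℝ q u Complex.I) w Complex.I = 0) :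
    ∀ l : ℂ, ∑ i : Fin n, ∫ t in (0 : ℝ)..1,
        Complex.exp (-(Complex.I * l * (z i + (t : ℂ) * (z (i + 1) - z i)))) *
          dqdz q (z i + (t : ℂ) * (z (i + 1) - z i)) * (z (i + 1) - z i) = 0 := by
  intro l
  have hK : IsCompact (convexHull ℝ (Set.range z)) := (Set.finite_range z).isCompact_convexHull (𝕜 := ℝ)
  obtain ⟨δ, hδ, hδU⟩ := hK.exists_thickening_subset_open hU hΩU
  set V := Metric.thickening δ (convexHull ℝ (Set.range z))
  have hVo : IsOpen V := Metric.isOpen_thickening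
  have hVc : Convex ℝ V := (convex_convexHull ℝ (Set.range z)).thickening δ
  have hzV : ∀ i, z i ∈ V := fun i =>
    Metric.self_subset_thickening hδ _ (subset_convexHull ℝ (Set.range z) (Set.mem_range_self i))
  have hf : DifferentiableOn ℂ (fun w => Complex.exp (-(Complex.I * l * w)) * dqdz q w) V := by
    intro w hw
    have hd := differentiableAt_dqdz (harmonicAt_of_fderiv_fderiv_add_eq_zero hU hq hharm (hδU hw))
    have hexp : DifferentiableAt ℂ (fun w => Complex.exp (-(Complex.I * l * w))) w := by fun_prop
    exact (hexp.mul hd).differentiableWithinAt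
  obtain ⟨F, hF⟩ := hf.exists_primitive_of_convex hVc hVo
  rw [Finset.sum_congr rfl fun i _ => integral_segment_eq_sub_of_hasDerivAt hVc hf.continuousOn hF
    (hzV i) (hzV (i + 1)), Finset.sum_sub_distrib, sub_eq_zero]
  exact Equiv.sum_comp (Equiv.addRight (1 : Fin n)) fun i => F (z i)
end
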